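/- arXiv:0711.4914 — 6 statements merged into one kernel-verified Lean document; each statement's English description precedes it below -/
import Mathlib

section
/- Let y, z : ℝ → ℝ be differentiable on an open interval I, satisfying the system y'(x) = -y(x)² + z(x)², z'(x) = -2 y(x) z(x), with y(x)² + z(x)² ≠ 0 for all x ∈ I. Then the two functions x ↦ y(x)/(y(x)² + z(x)²) - x and x ↦ -z(x)/(y(x)² + z(x)²) are both constant on I. -/
open Set

/-- A real function with vanishing derivative on an open interval is constant there. -/
theorem exists_eq_const_of_hasDerivAt_zero {a b : ℝ} {f : ℝ → ℝ}
    (hf : ∀ x ∈ Ioo a b, HasDerivAt f 0 x) : ∃ c, ∀ x ∈ Ioo a b, f x = c :=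
  isOpen_Ioo.exists_is_const_of_deriv_eq_zero isPreconnected_Ioo
    (fun x hx => (hf x hx).differentiableAt.differentiableWithinAt)
    (fun x hx => (hf x hx).deriv)

/-- The real transformation `Υ = y/(y²+z²) - x`, `ζ = -z/(y²+z²)` sends any solution of the
system `y' = -y² + z²`, `z' = -2yz` (with `y² + z² ≠ 0`) on an open interval to constants. -/
theorem riccati_system_transform_constant (a b : ℝ) (y z : ℝ → ℝ)
    (hy : ∀ x ∈ Ioo a b, HasDerivAt y (-(y x) ^ 2 + (z x) ^ 2) x)
    (hz : ∀ x ∈ Ioo a b, HasDerivAt z (-2 * y x * z x) x)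
    (hne : ∀ x ∈ Ioo a b, (y x) ^ 2 + (z x) ^ 2 ≠ 0) :
    ∃ c₁ c₂ : ℝ, ∀ x ∈ Ioo a b,
      y x / ((y x) ^ 2 + (z x) ^ 2) - x = c₁ ∧
      -z x / ((y x) ^ 2 + (z x) ^ 2) = c₂ := by
  have hsq : ∀ x ∈ Ioo a b,
      HasDerivAt (fun t => (y t) ^ 2 + (z t) ^ 2) (-2 * y x * ((y x) ^ 2 + (z x) ^ 2)) x := by
    intro x hx
    refine (((hy x hx).pow 2).add ((hz x hx).pow 2)).congr_deriv ?_
    push_cast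
    ring
  obtain ⟨c₁, h₁⟩ := exists_eq_const_of_hasDerivAt_zero
    (f := fun x => y x / ((y x) ^ 2 + (z x) ^ 2) - x) (a := a) (b := b) (by
      intro x hx
      have hx₀ := hne x hx
      refine (((hy x hx).div (hsq x hx) hx₀).sub (hasDerivAt_id x)).congr_deriv ?_
      field_simp
      ring)
  obtain ⟨c₂, h₂⟩ := exists_eq_const_of_hasDerivAt_zero
    (f := fun x => -z x / ((y x) ^ 2 + (z x) ^ 2)) (a := a) (b := b) (by
      intro x hx
      have hx₀ := hne x hx
      refine ((hz x hx).neg.div (hsq x hx) hx₀).congr_deriv ?_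
      simp only [Pi.neg_apply]
      field_simp
      ring)
  exact ⟨c₁, c₂, fun x hx => ⟨h₁ x hx, h₂ x hx⟩⟩
end

section
/- Let w₁, w₂ : ℝ → ℝ and let y, z : I → ℝ be twice differentiable on an open interval I with y(x)² + z(x)² ≠ 0 for all x ∈ I, satisfying the system y y'' - z z'' = y'² - z'² + w₁(x)(y² - z²) - 2 y z w₂(x) and y z'' + z y'' = 2 y' z' + 2 w₁(x) y z + w₂(x)(y² - z²). Then the function x ↦ ½ ln( y(x)² + z(x)² ) is twice differentiable on I and its second derivative equals w₁(x) for every x ∈ I. -/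
open Set

/-- The logarithmic derivative of the modulus of `y + iz`. -/
lemma hasDerivAt_half_log_sq_add_sq {y z : ℝ → ℝ} {y' z' x : ℝ}
    (hy : HasDerivAt y y' x) (hz : HasDerivAt z z' x) (hne : y x ^ 2 + z x ^ 2 ≠ 0) :
    HasDerivAt (fun t => (1 / 2) * Real.log (y t ^ 2 + z t ^ 2))
      ((y x * y' + z x * z') / (y x ^ 2 + z x ^ 2)) x := by
  refine ((((hy.fun_pow 2).fun_add (hz.fun_pow 2)).log hne).const_mul (1 / 2 : ℝ)).congr_deriv ?_
  field_simp
  push_cast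
  ring

/-- For solutions of the real system corresponding to `u u'' = u'² + w u²` (with `u = y + iz`,
`w = w₁ + i w₂`) on an open interval with `y² + z² ≠ 0`, the function `½ ln(y² + z²)` is
twice differentiable with second derivative `w₁`. -/
theorem log_modulus_second_deriv (w₁ w₂ : ℝ → ℝ) (a b : ℝ) (y z : ℝ → ℝ)
    (hy : ∀ x ∈ Ioo a b, DifferentiableAt ℝ y x)
    (hy' : ∀ x ∈ Ioo a b, DifferentiableAt ℝ (deriv y) x)
    (hz : ∀ x ∈ Ioo a b, DifferentiableAt ℝ z x)
    (hz' : ∀ x ∈ Ioo a b, DifferentiableAt ℝ (deriv z) x)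
    (hne : ∀ x ∈ Ioo a b, (y x) ^ 2 + (z x) ^ 2 ≠ 0)
    (heq1 : ∀ x ∈ Ioo a b,
      y x * deriv (deriv y) x - z x * deriv (deriv z) x =
        (deriv y x) ^ 2 - (deriv z x) ^ 2 + w₁ x * ((y x) ^ 2 - (z x) ^ 2) -
          2 * y x * z x * w₂ x)
    (heq2 : ∀ x ∈ Ioo a b,
      y x * deriv (deriv z) x + z x * deriv (deriv y) x =
        2 * deriv y x * deriv z x + 2 * w₁ x * y x * z x +
          w₂ x * ((y x) ^ 2 - (z x) ^ 2)) :
    ∀ x ∈ Ioo a b,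
      DifferentiableAt ℝ (fun t => (1 / 2) * Real.log ((y t) ^ 2 + (z t) ^ 2)) x ∧
      DifferentiableAt ℝ (deriv (fun t => (1 / 2) * Real.log ((y t) ^ 2 + (z t) ^ 2))) x ∧
      deriv (deriv (fun t => (1 / 2) * Real.log ((y t) ^ 2 + (z t) ^ 2))) x = w₁ x := by
  intro x hx
  have hfirst : ∀ t ∈ Ioo a b,
      HasDerivAt (fun t => (1 / 2) * Real.log ((y t) ^ 2 + (z t) ^ 2))
        ((y t * deriv y t + z t * deriv z t) / (y t ^ 2 + z t ^ 2)) t := fun t ht =>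
    hasDerivAt_half_log_sq_add_sq (hy t ht).hasDerivAt (hz t ht).hasDerivAt (hne t ht)
  have hEq : deriv (fun t => (1 / 2) * Real.log ((y t) ^ 2 + (z t) ^ 2)) =ᶠ[nhds x]
      fun t => (y t * deriv y t + z t * deriv z t) / (y t ^ 2 + z t ^ 2) := by
    filter_upwards [isOpen_Ioo.mem_nhds hx] with t ht using (hfirst t ht).deriv
  have hsecond : HasDerivAt (deriv (fun t => (1 / 2) * Real.log ((y t) ^ 2 + (z t) ^ 2)))
      (w₁ x) x := by
    refine HasDerivAt.congr_of_eventuallyEq ?_ hEq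
    have hyx := (hy x hx).hasDerivAt
    have hzx := (hz x hx).hasDerivAt
    have hr := hne x hx
    refine (((hyx.fun_mul (hy' x hx).hasDerivAt).fun_add
      (hzx.fun_mul (hz' x hx).hasDerivAt)).fun_div
      ((hyx.fun_pow 2).fun_add (hzx.fun_pow 2)) hr).congr_deriv ?_
    rw [div_eq_iff (pow_ne_zero 2 hr)]
    push_cast
    linear_combination (y x ^ 2 - z x ^ 2) * heq1 x hx + 2 * y x * z x * heq2 x hx
  exact ⟨(hfirst x hx).differentiableAt, hsecond.differentiableAt, hsecond.deriv⟩
end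

section
/- Let w₁, w₂ : ℝ → ℝ and let y, z : I → ℝ be twice differentiable on an open interval I with y(x) > 0 for all x ∈ I, satisfying the system y y'' - z z'' = y'² - z'² + w₁(x)(y² - z²) - 2 y z w₂(x) and y z'' + z y'' = 2 y' z' + 2 w₁(x) y z + w₂(x)(y² - z²). Then the function x ↦ arctan( z(x)/y(x) ) is twice differentiable on I and its second derivative equals w₂(x) for every x ∈ I. -/
open Set

theorem HasDerivAt.arctan_div {y z : ℝ → ℝ} {y' z' x : ℝ} (hy : HasDerivAt y y' x)
    (hz : HasDerivAt z z' x) (hx : y x ≠ 0) :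
    HasDerivAt (fun t => Real.arctan (z t / y t))
      ((y x * z' - z x * y') / (y x ^ 2 + z x ^ 2)) x := by
  have hN : y x ^ 2 + z x ^ 2 ≠ 0 := by positivity
  convert (hz.fun_div hy hx).arctan using 1
  field_simp

/-- For solutions of the real system corresponding to `u u'' = u'² + w u²` (with `u = y + iz`,
`w = w₁ + i w₂`) on an open interval with `y > 0`, the function `arctan(z/y)` is
twice differentiable with second derivative `w₂`. -/
theorem arctan_argument_second_deriv (w₁ w₂ : ℝ → ℝ) (a b : ℝ) (y z : ℝ → ℝ)
    (hy : ∀ x ∈ Ioo a b, DifferentiableAt ℝ y x)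
    (hy' : ∀ x ∈ Ioo a b, DifferentiableAt ℝ (deriv y) x)
    (hz : ∀ x ∈ Ioo a b, DifferentiableAt ℝ z x)
    (hz' : ∀ x ∈ Ioo a b, DifferentiableAt ℝ (deriv z) x)
    (hpos : ∀ x ∈ Ioo a b, 0 < y x)
    (heq1 : ∀ x ∈ Ioo a b,
      y x * deriv (deriv y) x - z x * deriv (deriv z) x =
        (deriv y x) ^ 2 - (deriv z x) ^ 2 + w₁ x * ((y x) ^ 2 - (z x) ^ 2) -
          2 * y x * z x * w₂ x)
    (heq2 : ∀ x ∈ Ioo a b,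
      y x * deriv (deriv z) x + z x * deriv (deriv y) x =
        2 * deriv y x * deriv z x + 2 * w₁ x * y x * z x +
          w₂ x * ((y x) ^ 2 - (z x) ^ 2)) :
    ∀ x ∈ Ioo a b,
      DifferentiableAt ℝ (fun t => Real.arctan (z t / y t)) x ∧
      DifferentiableAt ℝ (deriv (fun t => Real.arctan (z t / y t))) x ∧
      deriv (deriv (fun t => Real.arctan (z t / y t))) x = w₂ x := by
  have hderiv : ∀ x ∈ Ioo a b, HasDerivAt (fun t => Real.arctan (z t / y t))
      ((y x * deriv z x - z x * deriv y x) / (y x ^ 2 + z x ^ 2)) x := fun x hx =>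
    (hy x hx).hasDerivAt.arctan_div (hz x hx).hasDerivAt (hpos x hx).ne'
  intro x hx
  have hN : y x ^ 2 + z x ^ 2 ≠ 0 := by
    have := hpos x hx
    positivity
  have hEq : deriv (fun t => Real.arctan (z t / y t)) =ᶠ[nhds x]
      fun t => (y t * deriv z t - z t * deriv y t) / (y t ^ 2 + z t ^ 2) := by
    filter_upwards [isOpen_Ioo.mem_nhds hx] with t ht using (hderiv t ht).deriv
  have hY := (hy x hx).hasDerivAt
  have hZ := (hz x hx).hasDerivAt
  have hquot := ((hY.fun_mul (hz' x hx).hasDerivAt).fun_sub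
    (hZ.fun_mul (hy' x hx).hasDerivAt)).fun_div ((hY.fun_pow 2).fun_add (hZ.fun_pow 2)) hN
  have hsecond : HasDerivAt (deriv fun t => Real.arctan (z t / y t)) (w₂ x) x := by
    refine (hquot.congr_of_eventuallyEq hEq).congr_deriv ?_
    rw [div_eq_iff (pow_ne_zero 2 hN)]
    linear_combination (y x ^ 2 - z x ^ 2) * heq2 x hx - 2 * y x * z x * heq1 x hx
  exact ⟨(hderiv x hx).differentiableAt, hsecond.differentiableAt, hsecond.deriv⟩
end

section
/- Let u : I → ℂ be twice differentiable on an open interval I with u''(x) + 3 u(x) u'(x) + u(x)³ = 0 and u(x)² + u'(x) ≠ 0 for all x ∈ I. Then the function x ↦ x - u(x)/( u(x)² + u'(x) ) is constant on I. -/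
open Set

/-- The transformation linearizing `u'' + 3uu' + u³ = 0`: for any solution on an open
interval with `u² + u' ≠ 0`, the function `x - u/(u² + u')` is a first integral
(it is constant on the interval). -/
theorem cubic_equation_first_integral (a b : ℝ) (u : ℝ → ℂ)
    (hu : ∀ x ∈ Ioo a b, DifferentiableAt ℝ u x)
    (hu' : ∀ x ∈ Ioo a b, DifferentiableAt ℝ (deriv u) x)
    (heq : ∀ x ∈ Ioo a b,
      deriv (deriv u) x + 3 * u x * deriv u x + (u x) ^ 3 = 0)
    (hne : ∀ x ∈ Ioo a b, (u x) ^ 2 + deriv u x ≠ 0) :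
    ∃ c : ℂ, ∀ x ∈ Ioo a b,
      (x : ℂ) - u x / ((u x) ^ 2 + deriv u x) = c := by
  have hderiv : ∀ x ∈ Ioo a b,
      HasDerivAt (fun x : ℝ => (x : ℂ) - u x / ((u x) ^ 2 + deriv u x)) 0 x := by
    intro x hx
    have h₁ := (hu x hx).hasDerivAt
    have h₂ := (hu' x hx).hasDerivAt
    refine ((Complex.ofRealCLM.hasDerivAt (x := x)).sub
      (h₁.div ((h₁.pow 2).add h₂) (hne x hx))).congr_deriv ?_
    have h₃ : deriv (deriv u) x = -(3 * u x * deriv u x + (u x) ^ 3) := by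
      linear_combination heq x hx
    have h₄ := hne x hx
    simp only [Pi.add_apply, Pi.pow_apply, Complex.ofRealCLM_apply, Complex.ofReal_one, h₃]
    field_simp
    push_cast
    ring
  exact isOpen_Ioo.exists_is_const_of_deriv_eq_zero isPreconnected_Ioo
    (fun x hx => (hderiv x hx).differentiableAt.differentiableWithinAt)
    (fun x hx => (hderiv x hx).deriv)
end

section
/- Let α₁, α₂, β₁, β₂ ∈ ℝ. Set R(x) = x² - 2α₁x - 2β₁, S(x) = 2α₂x + 2β₂, Δ(x) = R(x)² + S(x)², and define y(x) = ( 2(x - α₁) R(x) + 4α₂(α₂ x + β₂) ) / Δ(x), z(x) = ( 4(x - α₁)(α₂ x + β₂) - 2α₂ R(x) ) / Δ(x). Then at every real x with Δ(x) ≠ 0, the pair (y, z) satisfies y'' = -3( y y' - z z' ) - ( y³ - 3 y z² ) and z'' = -3( z y' + y z' ) - ( 3 y² z - z³ ). -/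
/-- Real form of `(1 / P)' = -(P' / P) (1 / P)`, for `P = R - iS`: the derivatives of the real and
imaginary parts `R / (R² + S²)` and `S / (R² + S²)` of `1 / P`. -/
theorem hasDerivAt_inv_parts {R S : ℝ → ℝ} {A B x : ℝ}
    (hR : HasDerivAt R A x) (hS : HasDerivAt S B x) (h : R x ^ 2 + S x ^ 2 ≠ 0) :
    let p : ℝ → ℝ := fun t => R t / (R t ^ 2 + S t ^ 2)
    let q : ℝ → ℝ := fun t => S t / (R t ^ 2 + S t ^ 2)
    HasDerivAt p (-((A * p x + B * q x) * p x - (A * q x - B * p x) * q x)) x ∧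
      HasDerivAt q (-((A * p x + B * q x) * q x + (A * q x - B * p x) * p x)) x := by
  intro p q
  have hD : HasDerivAt (fun t => R t ^ 2 + S t ^ 2) (2 * R x * A + 2 * S x * B) x := by
    refine ((hR.pow 2).add (hS.pow 2)).congr_deriv ?_
    simp
  constructor
  · refine (hR.div hD h).congr_deriv ?_
    simp only [p, q]
    field_simp
    ring
  · refine (hS.div hD h).congr_deriv ?_
    simp only [p, q]
    field_simp
    ring

/-- The explicit general solution of the real system `y'' = -3(yy' - zz') - (y³ - 3yz²)`,
`z'' = -3(zy' + yz') - (3y²z - z³)`, obtained as real and imaginary parts of the complex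
solution `u = 2(x-α)/(x² - 2αx - 2β)` with `α = α₁ + iα₂`, `β = β₁ + iβ₂`. -/
theorem cubic_system_explicit_solution (α₁ α₂ β₁ β₂ : ℝ)
    (R S Δ y z : ℝ → ℝ)
    (hR : ∀ x, R x = x ^ 2 - 2 * α₁ * x - 2 * β₁)
    (hS : ∀ x, S x = 2 * α₂ * x + 2 * β₂)
    (hΔ : ∀ x, Δ x = (R x) ^ 2 + (S x) ^ 2)
    (hy : ∀ x, y x = (2 * (x - α₁) * R x + 4 * α₂ * (α₂ * x + β₂)) / Δ x)
    (hz : ∀ x, z x = (4 * (x - α₁) * (α₂ * x + β₂) - 2 * α₂ * R x) / Δ x) :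
    ∀ x : ℝ, Δ x ≠ 0 →
      DifferentiableAt ℝ y x ∧ DifferentiableAt ℝ (deriv y) x ∧
      DifferentiableAt ℝ z x ∧ DifferentiableAt ℝ (deriv z) x ∧
      deriv (deriv y) x =
        -3 * (y x * deriv y x - z x * deriv z x) - ((y x) ^ 3 - 3 * y x * (z x) ^ 2) ∧
      deriv (deriv z) x =
        -3 * (z x * deriv y x + y x * deriv z x) - (3 * (y x) ^ 2 * z x - (z x) ^ 3) := by
  have hR' (x : ℝ) : HasDerivAt R (2 * (x - α₁)) x := by
    rw [funext hR]
    refine ((((hasDerivAt_id x).pow 2).sub ((hasDerivAt_id x).const_mul (2 * α₁))).sub_const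
      (2 * β₁)).congr_deriv ?_
    simp
    ring
  have hS' (x : ℝ) : HasDerivAt S (2 * α₂) x := by
    rw [funext hS]
    simpa using ((hasDerivAt_id x).const_mul (2 * α₂)).add_const (2 * β₂)
  set p : ℝ → ℝ := fun t => R t / (R t ^ 2 + S t ^ 2) with hp
  set q : ℝ → ℝ := fun t => S t / (R t ^ 2 + S t ^ 2) with hq
  have hyp (x : ℝ) : y x = 2 * (x - α₁) * p x + 2 * α₂ * q x := by
    rw [hy, hΔ]
    simp only [hp, hq]
    rw [show 4 * α₂ * (α₂ * x + β₂) = 2 * α₂ * S x by rw [hS]; ring]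
    ring
  have hzp (x : ℝ) : z x = 2 * (x - α₁) * q x - 2 * α₂ * p x := by
    rw [hz, hΔ]
    simp only [hp, hq]
    rw [show 4 * (x - α₁) * (α₂ * x + β₂) = 2 * (x - α₁) * S x by rw [hS]; ring]
    ring
  have hpq (x : ℝ) (hx : Δ x ≠ 0) :
      HasDerivAt p (-(y x * p x - z x * q x)) x ∧ HasDerivAt q (-(y x * q x + z x * p x)) x := by
    rw [hyp, hzp]
    exact hasDerivAt_inv_parts (hR' x) (hS' x) (hΔ x ▸ hx)
  have hA (x : ℝ) : HasDerivAt (fun t : ℝ => 2 * (t - α₁)) 2 x := by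
    simpa using ((hasDerivAt_id x).sub_const α₁).const_mul 2
  have hy' (x : ℝ) (hx : Δ x ≠ 0) : HasDerivAt y (2 * p x - (y x ^ 2 - z x ^ 2)) x := by
    obtain ⟨h₁, h₂⟩ := hpq x hx
    have h := ((hA x).mul h₁).add (h₂.const_mul (2 * α₂))
    refine (h.congr_deriv ?_).congr_of_eventuallyEq (.of_forall hyp)
    rw [hyp, hzp]
    ring
  have hz' (x : ℝ) (hx : Δ x ≠ 0) : HasDerivAt z (2 * q x - 2 * y x * z x) x := by
    obtain ⟨h₁, h₂⟩ := hpq x hx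
    have h := ((hA x).mul h₂).sub (h₁.const_mul (2 * α₂))
    refine (h.congr_deriv ?_).congr_of_eventuallyEq (.of_forall hzp)
    rw [hyp, hzp]
    ring
  intro x hx
  have hcont : ContinuousAt Δ x := by
    rw [funext hΔ]
    exact ((hR' x).continuousAt.pow 2).add ((hS' x).continuousAt.pow 2)
  have hne := hcont.eventually_ne hx
  obtain ⟨h₁, h₂⟩ := hpq x hx
  have hy₁ := hy' x hx
  have hz₁ := hz' x hx
  have hy₂ := ((h₁.const_mul 2).sub ((hy₁.pow 2).sub (hz₁.pow 2))).congr_of_eventuallyEq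
    (hne.mono fun t ht => (hy' t ht).deriv)
  have hz₂ := ((h₂.const_mul 2).sub ((hy₁.const_mul 2).mul hz₁)).congr_of_eventuallyEq
    (hne.mono fun t ht => (hz' t ht).deriv)
  refine ⟨hy₁.differentiableAt, hy₂.differentiableAt, hz₁.differentiableAt,
    hz₂.differentiableAt, ?_, ?_⟩
  · rw [hy₂.deriv, hy₁.deriv, hz₁.deriv]
    ring
  · rw [hz₂.deriv, hy₁.deriv, hz₁.deriv]
    ring
end

section
/- Let α₁, α₂, β₁, β₂ ∈ ℝ and define, for x < β₁, y(x) = α₁ + x²/2 - ½ ln( (β₁ - x)² + β₂² ) and z(x) = α₂ - arctan( β₂ / (β₁ - x) ). Then for every x < β₁, y and z are twice differentiable and satisfy y''(x) = 1 + ( y'(x) - x )² - z'(x)² and z''(x) = 2 ( y'(x) - x ) z'(x). -/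
/-- The real and imaginary parts of the complex solution `u = α + x²/2 - log(β - x)`:
for `x < β₁`, the functions `y x = α₁ + x²/2 - ½ ln((β₁ - x)² + β₂²)` and
`z x = α₂ - arctan(β₂/(β₁ - x))` solve the system
`y'' = 1 + (y' - x)² - z'²`, `z'' = 2(y' - x)z'`. -/
theorem log_solution_real_system (α₁ α₂ β₁ β₂ : ℝ) (y z : ℝ → ℝ)
    (hy : ∀ x : ℝ, x < β₁ →
      y x = α₁ + x ^ 2 / 2 - (1 / 2) * Real.log ((β₁ - x) ^ 2 + β₂ ^ 2))
    (hz : ∀ x : ℝ, x < β₁ → z x = α₂ - Real.arctan (β₂ / (β₁ - x))) :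
    ∀ x : ℝ, x < β₁ →
      DifferentiableAt ℝ y x ∧ DifferentiableAt ℝ (deriv y) x ∧
      DifferentiableAt ℝ z x ∧ DifferentiableAt ℝ (deriv z) x ∧
      deriv (deriv y) x = 1 + (deriv y x - x) ^ 2 - (deriv z x) ^ 2 ∧
      deriv (deriv z) x = 2 * (deriv y x - x) * deriv z x := by
  have hD : ∀ x : ℝ, x < β₁ → (β₁ - x) ^ 2 + β₂ ^ 2 ≠ 0 := fun x hx => by
    have := sub_pos.2 hx
    positivity
  have hw : ∀ x : ℝ, HasDerivAt (fun t => β₁ - t) (-1) x := fun x => by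
    simpa using (hasDerivAt_id x).const_sub β₁
  have hDd : ∀ x : ℝ, HasDerivAt (fun t => (β₁ - t) ^ 2 + β₂ ^ 2) (-2 * (β₁ - x)) x :=
    fun x => (((hw x).fun_pow 2).add_const (β₂ ^ 2)).congr_deriv (by norm_num)
  have hy1 : ∀ x : ℝ, x < β₁ →
      HasDerivAt y (x + (β₁ - x) / ((β₁ - x) ^ 2 + β₂ ^ 2)) x := fun x hx => by
    have h := ((((hasDerivAt_id' x).fun_pow 2).div_const 2).const_add α₁).fun_sub
      (((hDd x).log (hD x hx)).const_mul (1 / 2))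
    refine (h.congr_of_eventuallyEq ?_).congr_deriv ?_
    · filter_upwards [Iio_mem_nhds hx] with t ht using hy t ht
    · have := hD x hx
      norm_num
      field_simp
      ring
  have hz1 : ∀ x : ℝ, x < β₁ →
      HasDerivAt z (-β₂ / ((β₁ - x) ^ 2 + β₂ ^ 2)) x := fun x hx => by
    have hne : β₁ - x ≠ 0 := (sub_pos.2 hx).ne'
    have h := ((((hasDerivAt_const x β₂).fun_div (hw x) hne)).arctan).const_sub α₂
    refine (h.congr_of_eventuallyEq ?_).congr_deriv ?_
    · filter_upwards [Iio_mem_nhds hx] with t ht using hz t ht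
    · have := hD x hx
      have h1 : 1 + (β₂ / (β₁ - x)) ^ 2 = ((β₁ - x) ^ 2 + β₂ ^ 2) / (β₁ - x) ^ 2 := by
        field_simp
      rw [h1]
      field_simp
      ring
  intro x hx
  have hDx := hD x hx
  have hy2 : HasDerivAt (deriv y)
      (1 + ((β₁ - x) ^ 2 - β₂ ^ 2) / ((β₁ - x) ^ 2 + β₂ ^ 2) ^ 2) x := by
    have h := (hasDerivAt_id' x).fun_add ((hw x).fun_div (hDd x) hDx)
    refine (h.congr_of_eventuallyEq ?_).congr_deriv ?_
    · filter_upwards [Iio_mem_nhds hx] with t ht using (hy1 t ht).deriv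
    · ring
  have hz2 : HasDerivAt (deriv z)
      (-2 * β₂ * (β₁ - x) / ((β₁ - x) ^ 2 + β₂ ^ 2) ^ 2) x := by
    have h := (hasDerivAt_const x (-β₂)).fun_div (hDd x) hDx
    refine (h.congr_of_eventuallyEq ?_).congr_deriv ?_
    · filter_upwards [Iio_mem_nhds hx] with t ht using (hz1 t ht).deriv
    · ring
  refine ⟨(hy1 x hx).differentiableAt, hy2.differentiableAt, (hz1 x hx).differentiableAt,
    hz2.differentiableAt, ?_, ?_⟩
  · rw [hy2.deriv, (hy1 x hx).deriv, (hz1 x hx).deriv]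
    field_simp
    ring
  · rw [hz2.deriv, (hy1 x hx).deriv, (hz1 x hx).deriv]
    field_simp
    ring
end
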